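/- Let V be a 6-dimensional real vector space with basis v₁,…,v₆, dual basis v¹,…,v⁶, and vol = v¹∧…∧v⁶. Let ψ ∈ Λ³V* be such that every monomial of ψ contains v¹ or v² (equivalently ψ(x,y,z) = 0 whenever x,y,z ∈ span(v₃,v₄,v₅,v₆)). Let K_ψ : V → V be the unique linear map with ι_{K_ψ(x)} vol = ι_x ψ ∧ ψ for all x. Then K_ψ maps the subspace W = span(v₃,v₄,v₅,v₆) into itself; equivalently, (ι_{v_j} ψ) ∧ ψ ∧ v¹ = 0 and (ι_{v_j} ψ) ∧ ψ ∧ v² = 0 for j = 3,4,5,6. (This is the invariance claim proved inside Corollary 'cor:lem2' of the paper, showing W is a complex subspace for the almost complex structure induced by ψ.) -/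

import Mathlib

set_option synthInstance.maxHeartbeats 1000000
set_option maxHeartbeats 1000000

open ExteriorAlgebra Module

noncomputable section

/-- The degree-`k` homogeneous component of the exterior algebra of `V`. -/
def degPart (V : Type*) [AddCommGroup V] [Module ℝ V] (k : ℕ) :
    Submodule ℝ (ExteriorAlgebra ℝ V) :=
  LinearMap.range (ExteriorAlgebra.ι ℝ : V →ₗ[ℝ] ExteriorAlgebra ℝ V) ^ k

/-- `c` is the interior product (contraction) with the vector `X : V` on `Λ V*`. -/
def IsContraction {V : Type*} [AddCommGroup V] [Module ℝ V] (X : V)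
    (c : ExteriorAlgebra ℝ (Dual ℝ V) →ₗ[ℝ] ExteriorAlgebra ℝ (Dual ℝ V)) : Prop :=
  (∀ k, ∀ x ∈ degPart (Dual ℝ V) k, ∀ y,
      c (x * y) = c x * y + ((-1 : ℝ)) ^ k • (x * c y)) ∧
  (∀ α : Dual ℝ V, c (ExteriorAlgebra.ι ℝ α) = algebraMap ℝ _ (α X))

/-- The volume form `v¹ ∧ ⋯ ∧ v⁶ ∈ Λ⁶ V*` associated to a basis. -/
def volForm {V : Type*} [AddCommGroup V] [Module ℝ V] (b : Basis (Fin 6) ℝ V) :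
    ExteriorAlgebra ℝ (Dual ℝ V) :=
  (List.ofFn fun j : Fin 6 => ExteriorAlgebra.ι ℝ (b.dualBasis j)).prod

section Swap

variable {M : Type*} [AddCommGroup M] [Module ℝ M]

lemma ι_mul_eq_involute_mul (α : M) (x : ExteriorAlgebra ℝ M) :
    ι ℝ α * x = CliffordAlgebra.involute x * ι ℝ α := by
  induction x using ExteriorAlgebra.induction with
  | algebraMap r => rw [AlgHom.commutes, Algebra.commutes]
  | ι β =>
    have h : CliffordAlgebra.involute (ι ℝ β) = -ι ℝ β := CliffordAlgebra.involute_ι β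
    rw [h, neg_mul]
    exact eq_neg_of_add_eq_zero_left (ι_add_mul_swap α β)
  | mul x y hx hy => rw [map_mul, ← mul_assoc, hx, mul_assoc, hy, mul_assoc]
  | add x y hx hy => rw [map_add, mul_add, hx, hy, add_mul]

lemma mul_ι_eq_ι_mul_involute (α : M) (x : ExteriorAlgebra ℝ M) :
    x * ι ℝ α = ι ℝ α * CliffordAlgebra.involute x := by
  rw [ι_mul_eq_involute_mul, CliffordAlgebra.involute_involute]

lemma ι_mul_mul_ι_self (α : M) (x : ExteriorAlgebra ℝ M) : ι ℝ α * x * ι ℝ α = 0 := by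
  rw [ι_mul_eq_involute_mul, mul_assoc, ι_sq_zero, mul_zero]

lemma mul_mul_ι_eq_zero_of_mem_span_pair {α β : M} {ω η : ExteriorAlgebra ℝ M}
    (hω : ω ∈ Ideal.span {ι ℝ α, ι ℝ β}) (hη : η ∈ Ideal.span {ι ℝ α, ι ℝ β}) :
    ω * η * ι ℝ α = 0 := by
  obtain ⟨a, c, rfl⟩ := Submodule.mem_span_pair.1 hω
  obtain ⟨a', c', rfl⟩ := Submodule.mem_span_pair.1 hη
  have h₁ : a * ι ℝ α * (a' * ι ℝ α + c' * ι ℝ β) * ι ℝ α = 0 := by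
    rw [mul_assoc a, mul_assoc a, ι_mul_mul_ι_self, mul_zero]
  have h₂ : c * ι ℝ β * (a' * ι ℝ α) * ι ℝ α = 0 := by
    rw [mul_assoc, mul_assoc a', ι_sq_zero, mul_zero, mul_zero]
  have h₃ : c * ι ℝ β * (c' * ι ℝ β) = 0 := by
    rw [mul_assoc, ← mul_assoc (ι ℝ β), ι_mul_mul_ι_self, mul_zero]
  simp only [smul_eq_mul]
  rw [add_mul, add_mul, h₁, mul_add, add_mul, h₂, h₃, zero_mul, add_zero, add_zero]

end Swap

section Contraction

variable {V : Type*} [AddCommGroup V] [Module ℝ V]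

lemma ι_mem_degPart_one (α : V) : ι ℝ α ∈ degPart V 1 := by
  rw [degPart, pow_one]
  exact LinearMap.mem_range_self _ _

namespace IsContraction

variable {X : V} {c : ExteriorAlgebra ℝ (Dual ℝ V) →ₗ[ℝ] ExteriorAlgebra ℝ (Dual ℝ V)}

lemma ι_mul (h : IsContraction X c) (α : Dual ℝ V) (y : ExteriorAlgebra ℝ (Dual ℝ V)) :
    c (ι ℝ α * y) = α X • y - ι ℝ α * c y := by
  rw [h.1 1 _ (ι_mem_degPart_one α) y, h.2, ← Algebra.smul_def, pow_one, neg_one_smul,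
    sub_eq_add_neg]

lemma map_one (h : IsContraction X c) : c 1 = 0 := by
  have h₁ := h.1 0 1 (by rw [degPart, pow_zero]; exact Submodule.one_le.1 le_rfl) 1
  simpa using h₁

lemma map_algebraMap (h : IsContraction X c) (r : ℝ) : c (algebraMap ℝ _ r) = 0 := by
  rw [Algebra.algebraMap_eq_smul_one, map_smul, h.map_one, smul_zero]

lemma map_mem_degPart (h : IsContraction X c) {k : ℕ} {ω : ExteriorAlgebra ℝ (Dual ℝ V)}
    (hω : ω ∈ degPart (Dual ℝ V) (k + 1)) : c ω ∈ degPart (Dual ℝ V) k := by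
  induction k generalizing ω with
  | zero =>
    rw [degPart, zero_add, pow_one] at hω
    obtain ⟨α, rfl⟩ := hω
    rw [h.2, degPart, pow_zero]
    exact Submodule.algebraMap_mem _
  | succ k ih =>
    rw [degPart, pow_succ'] at hω
    induction hω using Submodule.mul_induction_on' with
    | mem_mul_mem x hx y hy =>
      obtain ⟨α, rfl⟩ := hx
      rw [h.ι_mul]
      refine sub_mem (Submodule.smul_mem _ _ hy) ?_
      rw [degPart, pow_succ']
      exact Submodule.mul_mem_mul (LinearMap.mem_range_self _ _) (ih hy)
    | add x _ y _ hx hy => rw [map_add]; exact add_mem hx hy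

lemma map_mem_span_pair (h : IsContraction X c) {α β : Dual ℝ V} (hα : α X = 0) (hβ : β X = 0)
    {ω : ExteriorAlgebra ℝ (Dual ℝ V)} (hω : ω ∈ Ideal.span {ι ℝ α, ι ℝ β}) :
    c ω ∈ Ideal.span {ι ℝ α, ι ℝ β} := by
  obtain ⟨a, a', rfl⟩ := Submodule.mem_span_pair.1 hω
  rw [smul_eq_mul, smul_eq_mul, mul_ι_eq_ι_mul_involute, mul_ι_eq_ι_mul_involute, map_add,
    h.ι_mul, h.ι_mul, hα, hβ, zero_smul, zero_smul, zero_sub, zero_sub,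
    ι_mul_eq_involute_mul, ι_mul_eq_involute_mul]
  exact add_mem (neg_mem (Ideal.mul_mem_left _ _ (Ideal.subset_span (by simp))))
    (neg_mem (Ideal.mul_mem_left _ _ (Ideal.subset_span (by simp))))

end IsContraction

/-- Euler's identity: `∑ vⁱ ∧ ι_{vᵢ}` acts on `k`-forms as multiplication by `k`. -/
lemma sum_ι_dualBasis_mul_contraction {n : Type*} [Fintype n] [DecidableEq n] (b : Basis n ℝ V)
    {C : V → (ExteriorAlgebra ℝ (Dual ℝ V) →ₗ[ℝ] ExteriorAlgebra ℝ (Dual ℝ V))}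
    (hC : ∀ x, IsContraction x (C x)) {k : ℕ} {ω : ExteriorAlgebra ℝ (Dual ℝ V)}
    (hω : ω ∈ degPart (Dual ℝ V) k) :
    ∑ i, ι ℝ (b.dualBasis i) * C (b i) ω = (k : ℝ) • ω := by
  induction k generalizing ω with
  | zero =>
    rw [degPart, pow_zero] at hω
    obtain ⟨r, rfl⟩ := Submodule.mem_one.1 hω
    simp [(hC _).map_algebraMap]
  | succ k ih =>
    rw [degPart, pow_succ'] at hω
    induction hω using Submodule.mul_induction_on' with
    | mem_mul_mem x hx y hy =>
      obtain ⟨α, rfl⟩ := hx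
      have hα : ∑ i, α (b i) • ι ℝ (b.dualBasis i) = ι ℝ α := by
        simp_rw [← map_smul, ← map_sum]
        congr 1
        refine b.ext fun j => ?_
        simp
      have key : ∀ i, ι ℝ (b.dualBasis i) * C (b i) (ι ℝ α * y) =
          (α (b i) • ι ℝ (b.dualBasis i)) * y + ι ℝ α * (ι ℝ (b.dualBasis i) * C (b i) y) := by
        intro i
        have hs := eq_neg_of_add_eq_zero_left (ι_add_mul_swap (R := ℝ) (b.dualBasis i) α)
        rw [(hC _).ι_mul, mul_sub, mul_smul_comm, smul_mul_assoc, ← mul_assoc, hs, neg_mul,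
          sub_neg_eq_add, mul_assoc]
      rw [Finset.sum_congr rfl fun i _ => key i, Finset.sum_add_distrib, ← Finset.sum_mul, hα,
        ← Finset.mul_sum, ih hy, mul_smul_comm]
      push_cast
      rw [add_smul, one_smul, add_comm]
    | add x _ y _ hx hy => simp only [map_add, mul_add, Finset.sum_add_distrib, hx, hy, smul_add]

/-- A form of positive degree lies in the ideal generated by two dual basis elements as soon as its
contractions with the remaining basis vectors do. -/
lemma mem_span_pair_of_contraction_mem {n : Type*} [Fintype n] [DecidableEq n] (b : Basis n ℝ V)
    {C : V → (ExteriorAlgebra ℝ (Dual ℝ V) →ₗ[ℝ] ExteriorAlgebra ℝ (Dual ℝ V))}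
    (hC : ∀ x, IsContraction x (C x)) {k : ℕ} {ω : ExteriorAlgebra ℝ (Dual ℝ V)}
    (hω : ω ∈ degPart (Dual ℝ V) (k + 1)) (p q : n)
    (h : ∀ i, i ≠ p → i ≠ q →
      C (b i) ω ∈ Ideal.span {ι ℝ (b.dualBasis p), ι ℝ (b.dualBasis q)}) :
    ω ∈ Ideal.span {ι ℝ (b.dualBasis p), ι ℝ (b.dualBasis q)} := by
  have hsum := sum_ι_dualBasis_mul_contraction b hC hω
  have hk : ((k + 1 : ℕ) : ℝ) ≠ 0 := Nat.cast_ne_zero.2 k.succ_ne_zero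
  rw [← inv_smul_smul₀ hk ω, ← hsum, Algebra.smul_def]
  refine Ideal.mul_mem_left _ _ (sum_mem fun i _ => ?_)
  by_cases hp : i = p
  · rw [hp, ι_mul_eq_involute_mul]
    exact Ideal.mul_mem_left _ _ (Ideal.subset_span (by simp))
  by_cases hq : i = q
  · rw [hq, ι_mul_eq_involute_mul]
    exact Ideal.mul_mem_left _ _ (Ideal.subset_span (by simp))
  exact Ideal.mul_mem_left _ _ (h i hp hq)

lemma volForm_ne_zero (b : Basis (Fin 6) ℝ V)
    {C : V → (ExteriorAlgebra ℝ (Dual ℝ V) →ₗ[ℝ] ExteriorAlgebra ℝ (Dual ℝ V))}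
    (hC : ∀ x, IsContraction x (C x)) : volForm b ≠ 0 := by
  intro h
  have h₁ : C (b 5) (C (b 4) (C (b 3) (C (b 2) (C (b 1) (C (b 0) (volForm b)))))) = 1 := by
    simp [volForm, List.ofFn_succ, (hC _).ι_mul, (hC _).2, Fin.ext_iff]
  simp [h] at h₁

lemma volForm_mul_ι_dualBasis (b : Basis (Fin 6) ℝ V) (i : Fin 6) :
    volForm b * ι ℝ (b.dualBasis i) = 0 := by
  obtain ⟨s, t, h⟩ := List.append_of_mem
    ((List.mem_ofFn' (fun j : Fin 6 => ι ℝ (b.dualBasis j)) _).2 ⟨i, rfl⟩)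
  rw [volForm, h, List.prod_append, List.prod_cons, mul_assoc, ι_mul_mul_ι_self, mul_zero]

lemma volForm_mem_degPart (b : Basis (Fin 6) ℝ V) : volForm b ∈ degPart (Dual ℝ V) 6 := by
  rw [volForm, ← ιMulti_apply]
  exact (ιMulti_span_fixedDegree ℝ 6).le (Submodule.subset_span ⟨_, rfl⟩)

/-- If `ι_X vol ∧ vⁱ = 0`, then the `i`-th coordinate of `X` vanishes. -/
lemma dualBasis_apply_eq_zero_of_contraction_volForm (b : Basis (Fin 6) ℝ V)
    {C : V → (ExteriorAlgebra ℝ (Dual ℝ V) →ₗ[ℝ] ExteriorAlgebra ℝ (Dual ℝ V))}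
    (hC : ∀ x, IsContraction x (C x)) {X : V} {i : Fin 6}
    (h : C X (volForm b) * ι ℝ (b.dualBasis i) = 0) : b.dualBasis i X = 0 := by
  have h₁ := (hC X).1 6 _ (volForm_mem_degPart b) (ι ℝ (b.dualBasis i))
  rw [volForm_mul_ι_dualBasis, map_zero, h, (hC X).2, ← Algebra.commutes, ← Algebra.smul_def,
    zero_add, Even.neg_one_pow (by decide), one_smul] at h₁
  exact (smul_eq_zero.1 h₁.symm).resolve_right (volForm_ne_zero b hC)

lemma mem_span_basis_tail_iff (b : Basis (Fin 6) ℝ V) (x : V) :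
    x ∈ Submodule.span ℝ ({b 2, b 3, b 4, b 5} : Set V) ↔
      b.dualBasis 0 x = 0 ∧ b.dualBasis 1 x = 0 := by
  constructor
  · intro hx
    induction hx using Submodule.span_induction with
    | mem x hx =>
      rcases hx with rfl | rfl | rfl | rfl <;> simp [Fin.ext_iff]
    | zero => simp
    | add x y _ _ hx hy => rw [map_add, map_add, hx.1, hx.2, hy.1, hy.2]; simp
    | smul r x _ hx => rw [map_smul, map_smul, hx.1, hx.2]; simp
  · rintro ⟨h₀, h₁⟩
    rw [Basis.dualBasis_apply] at h₀ h₁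
    rw [← b.sum_repr x, Fin.sum_univ_six, h₀, h₁, zero_smul, zero_smul, zero_add, zero_add]
    refine add_mem (add_mem (add_mem ?_ ?_) ?_) ?_ <;>
      exact Submodule.smul_mem _ _ (Submodule.subset_span (by simp))

end Contraction

/-- Let `V` be 6-dimensional with basis `v₁,…,v₆`, `vol = v¹∧⋯∧v⁶`, and let
`ψ ∈ Λ³V*` be such that `ψ(x,y,z) = 0` whenever `x,y,z ∈ W = span(v₃,…,v₆)` (every monomial
of `ψ` contains `v¹` or `v²`).  Let `K_ψ : V → V` be the unique linear map with
`ι_{K_ψ x} vol = ι_x ψ ∧ ψ`.  Then `K_ψ` maps `W` into itself; equivalently,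
`(ι_{v_j} ψ) ∧ ψ ∧ v¹ = 0` and `(ι_{v_j} ψ) ∧ ψ ∧ v² = 0` for `j = 3,4,5,6`. -/
theorem K_preserves_W {V : Type*} [AddCommGroup V] [Module ℝ V]
    (b : Basis (Fin 6) ℝ V)
    (ψ : ExteriorAlgebra ℝ (Dual ℝ V)) (hψ : ψ ∈ degPart (Dual ℝ V) 3)
    (C : V → (ExteriorAlgebra ℝ (Dual ℝ V) →ₗ[ℝ] ExteriorAlgebra ℝ (Dual ℝ V)))
    (hC : ∀ x : V, IsContraction x (C x))
    (hmono : ∀ x ∈ Submodule.span ℝ {b 2, b 3, b 4, b 5},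
      ∀ y ∈ Submodule.span ℝ {b 2, b 3, b 4, b 5},
      ∀ z ∈ Submodule.span ℝ {b 2, b 3, b 4, b 5}, C x (C y (C z ψ)) = 0)
    (K : V →ₗ[ℝ] V)
    (hK : ∀ x : V, C (K x) (volForm b) = C x ψ * ψ) :
    (∀ x ∈ Submodule.span ℝ {b 2, b 3, b 4, b 5},
        K x ∈ Submodule.span ℝ ({b 2, b 3, b 4, b 5} : Set V)) ∧
    (∀ j : Fin 6, j ≠ 0 → j ≠ 1 →
      C (b j) ψ * ψ * ExteriorAlgebra.ι ℝ (b.dualBasis 0) = 0 ∧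
      C (b j) ψ * ψ * ExteriorAlgebra.ι ℝ (b.dualBasis 1) = 0) := by
  have hW : ∀ j : Fin 6, j ≠ 0 → j ≠ 1 →
      b j ∈ Submodule.span ℝ ({b 2, b 3, b 4, b 5} : Set V) := fun j h₀ h₁ => by
    rw [mem_span_basis_tail_iff, Basis.dualBasis_apply_self, Basis.dualBasis_apply_self]
    simp [h₀, h₁]
  have hψJ : ψ ∈ Ideal.span {ι ℝ (b.dualBasis 0), ι ℝ (b.dualBasis 1)} :=
    mem_span_pair_of_contraction_mem b hC hψ 0 1 fun i hi₀ hi₁ =>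
      mem_span_pair_of_contraction_mem b hC ((hC _).map_mem_degPart hψ) 0 1 fun j hj₀ hj₁ =>
        mem_span_pair_of_contraction_mem b hC
          ((hC _).map_mem_degPart ((hC _).map_mem_degPart hψ)) 0 1 fun k hk₀ hk₁ => by
            rw [hmono _ (hW k hk₀ hk₁) _ (hW j hj₀ hj₁) _ (hW i hi₀ hi₁)]
            exact zero_mem _
  have key : ∀ x ∈ Submodule.span ℝ ({b 2, b 3, b 4, b 5} : Set V),
      C x ψ * ψ * ι ℝ (b.dualBasis 0) = 0 ∧ C x ψ * ψ * ι ℝ (b.dualBasis 1) = 0 := by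
    intro x hx
    obtain ⟨h₀, h₁⟩ := (mem_span_basis_tail_iff b x).1 hx
    have hxJ := (hC x).map_mem_span_pair h₀ h₁ hψJ
    refine ⟨mul_mul_ι_eq_zero_of_mem_span_pair hxJ hψJ, ?_⟩
    rw [Set.pair_comm] at hxJ hψJ
    exact mul_mul_ι_eq_zero_of_mem_span_pair hxJ hψJ
  refine ⟨fun x hx => ?_, fun j h₀ h₁ => key _ (hW j h₀ h₁)⟩
  obtain ⟨h₀, h₁⟩ := key x hx
  rw [← hK x] at h₀ h₁
  exact (mem_span_basis_tail_iff b _).2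
    ⟨dualBasis_apply_eq_zero_of_contraction_volForm b hC h₀,
      dualBasis_apply_eq_zero_of_contraction_volForm b hC h₁⟩
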